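/- Let G be a maxnil graph with a vertex cut set S = {x, y} consisting of two distinct vertices, and let G_1, …, G_r be the connected components of G − S. Then xy is an edge of G, and for each i with 1 ≤ i ≤ r, the subgraph of G induced by V(G_i) ∪ S is maxnil. -/

import Mathlib

open SimpleGraph

/-- `H` is a minor of `G`: there is a family of nonempty, pairwise disjoint,
connected branch sets in `G`, one for each vertex of `H`, with an edge of `G`
between the branch sets of any two adjacent vertices of `H`. -/
def IsMinor {W V : Type} (H : SimpleGraph W) (G : SimpleGraph V) : Prop :=
  ∃ f : W → Set V,
    (∀ w, (f w).Nonempty) ∧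
    (∀ w, (G.induce (f w)).Connected) ∧
    (Pairwise fun w₁ w₂ => Disjoint (f w₁) (f w₂)) ∧
    ∀ ⦃w₁ w₂⦄, H.Adj w₁ w₂ → ∃ v₁ ∈ f w₁, ∃ v₂ ∈ f w₂, G.Adj v₁ v₂

/-- The result of a `∇Y`-move on the triangle `a b c` of `G`: delete the edges of
the triangle and add a new vertex (`none`) joined to `a`, `b`, `c`. -/
def triangleY {V : Type} (G : SimpleGraph V) (a b c : V) : SimpleGraph (Option V) :=
  (SimpleGraph.map Function.Embedding.some
      (G.deleteEdges {s(a, b), s(b, c), s(a, c)})) ⊔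
    SimpleGraph.fromEdgeSet {s((none : Option V), some a), s(none, some b), s(none, some c)}

/-- Membership in the Petersen family: the graphs obtained from `K₆` by
`∇Y`-moves and `Y∇`-moves (the inverse operation), up to isomorphism. -/
inductive IsPetersenFamily : ∀ {V : Type}, SimpleGraph V → Prop
  | k6 : IsPetersenFamily (⊤ : SimpleGraph (Fin 6))
  | deltaY {V : Type} {G : SimpleGraph V} {a b c : V} :
      IsPetersenFamily G → G.Adj a b → G.Adj b c → G.Adj a c →
      IsPetersenFamily (triangleY G a b c)
  | yDelta {V : Type} {G : SimpleGraph V} {a b c : V} :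
      IsPetersenFamily (triangleY G a b c) → G.Adj a b → G.Adj b c → G.Adj a c →
      IsPetersenFamily G
  | iso {V W : Type} {G : SimpleGraph V} {H : SimpleGraph W} :
      IsPetersenFamily G → G ≃g H → IsPetersenFamily H

/-- A graph is linklessly embeddable (nIL) iff it has no minor in the Petersen family. -/
def IsLinkless {V : Type} (G : SimpleGraph V) : Prop :=
  ∀ ⦃W : Type⦄ (P : SimpleGraph W), IsPetersenFamily P → ¬ IsMinor P G

/-- The graph obtained from `G` by adding the edge `ab`. -/
def addEdge {V : Type} (G : SimpleGraph V) (a b : V) : SimpleGraph V :=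
  G ⊔ SimpleGraph.fromEdgeSet {s(a, b)}

/-- A nIL graph is maxnil if adding any edge yields a graph that is not nIL. -/
def IsMaxnil {V : Type} (G : SimpleGraph V) : Prop :=
  IsLinkless G ∧ ∀ a b : V, a ≠ b → ¬ G.Adj a b → ¬ IsLinkless (addEdge G a b)

/-- `S` is a vertex cut set of the connected graph `G` if `G - S` is disconnected. -/
def IsVertexCut {V : Type} (G : SimpleGraph V) (S : Set V) : Prop :=
  G.Connected ∧ ¬ (G.induce Sᶜ).Preconnected

/-- A vertex cut set is minimal if no proper subset of it is a vertex cut set. -/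
def IsMinimalVertexCut {V : Type} (G : SimpleGraph V) (S : Set V) : Prop :=
  IsVertexCut G S ∧ ∀ S' ⊂ S, ¬ IsVertexCut G S'

/-- A set `T` of vertices of `H` (inducing a `K₄`) is strongly separating if `H - T`
has at least two connected components such that every vertex of `T` has a
neighbor in each of them. -/
def StronglySeparating {V : Type} (H : SimpleGraph V) (T : Set V) : Prop :=
  ∃ C₁ C₂ : (H.induce Tᶜ).ConnectedComponent, C₁ ≠ C₂ ∧
    ∀ v ∈ T, (∃ u ∈ C₁.supp, H.Adj v ↑u) ∧ (∃ u ∈ C₂.supp, H.Adj v ↑u)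

/-- `G` is maximal without a `K₆` minor. -/
def IsMaximalK6MinorFree {V : Type} (G : SimpleGraph V) : Prop :=
  ¬ IsMinor (⊤ : SimpleGraph (Fin 6)) G ∧
    ∀ a b : V, a ≠ b → ¬ G.Adj a b → IsMinor (⊤ : SimpleGraph (Fin 6)) (addEdge G a b)

/-! ### The seven graphs of the Petersen family, explicitly -/

namespace PF

/-- Orders of the seven graphs. -/
def sz : Fin 7 → ℕ := ![6, 7, 8, 8, 9, 7, 10]

/-- Adjacency bit masks: bit `16 u + v` is set iff `u`, `v` are adjacent. -/
def code : Fin 7 → ℕ := ![37477567420506345890971710,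
  554634615167270869762695495800,
  129807976097988053177920664777523424,
  290769178838295423044495475878658168,
  14291989218655810849266599119020864045280,
  4753790093746500224795451064380,
  1159653042312811059765506900677412451741860064]

/-- Boolean adjacency. -/
def A (i : Fin 7) (u v : ℕ) : Bool :=
  (!(Nat.beq u v)) && ((code i).testBit (16 * u + v) || (code i).testBit (16 * v + u))

/-- The `i`-th graph of the Petersen family. -/
def gr (i : Fin 7) : SimpleGraph (Fin (sz i)) where
  Adj u v := A i u v = true
  symm := ⟨by
    intro u v h
    simp only [A, Bool.and_eq_true, Bool.or_eq_true, Bool.not_eq_true'] at h ⊢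
    refine ⟨?_, h.2.symm⟩
    have := h.1
    by_contra h2
    rw [Bool.not_eq_false, Nat.beq_eq] at h2
    rw [h2] at this
    simp at this⟩
  loopless := ⟨by
    intro u h
    simp [A] at h⟩

/-- A `∇Y`-move `(j, a, b, c, i, σ)`: applying the move to the triangle `a b c` of graph `j`
yields graph `i`, through the bijection `σ` (the new vertex has number `sz j`). -/
abbrev Arrow := Fin 7 × ℕ × ℕ × ℕ × Fin 7 × List ℕ

/-- Representatives of all the moves. -/
def arrows : List Arrow := [
  (0, 0, 1, 2, 1, [0, 1, 2, 3, 4, 5, 6]),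
  (0, 0, 1, 3, 1, [0, 1, 3, 2, 4, 5, 6]),
  (0, 0, 1, 4, 1, [0, 1, 3, 4, 2, 5, 6]),
  (0, 0, 1, 5, 1, [0, 1, 3, 4, 5, 2, 6]),
  (0, 0, 2, 3, 1, [0, 3, 1, 2, 4, 5, 6]),
  (0, 0, 2, 4, 1, [0, 3, 1, 4, 2, 5, 6]),
  (0, 0, 2, 5, 1, [0, 3, 1, 4, 5, 2, 6]),
  (0, 0, 3, 4, 1, [0, 3, 4, 1, 2, 5, 6]),
  (0, 0, 3, 5, 1, [0, 3, 4, 1, 5, 2, 6]),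
  (0, 0, 4, 5, 1, [0, 3, 4, 5, 1, 2, 6]),
  (0, 1, 2, 3, 1, [3, 0, 1, 2, 4, 5, 6]),
  (0, 1, 2, 4, 1, [3, 0, 1, 4, 2, 5, 6]),
  (0, 1, 2, 5, 1, [3, 0, 1, 4, 5, 2, 6]),
  (0, 1, 3, 4, 1, [3, 0, 4, 1, 2, 5, 6]),
  (0, 1, 3, 5, 1, [3, 0, 4, 1, 5, 2, 6]),
  (0, 1, 4, 5, 1, [3, 0, 4, 5, 1, 2, 6]),
  (0, 2, 3, 4, 1, [3, 4, 0, 1, 2, 5, 6]),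
  (0, 2, 3, 5, 1, [3, 4, 0, 1, 5, 2, 6]),
  (0, 2, 4, 5, 1, [3, 4, 0, 5, 1, 2, 6]),
  (0, 3, 4, 5, 1, [3, 4, 5, 0, 1, 2, 6]),
  (1, 0, 3, 4, 2, [0, 3, 4, 1, 2, 5, 7, 6]),
  (1, 0, 3, 5, 2, [0, 1, 2, 3, 5, 4, 6, 7]),
  (1, 0, 4, 5, 2, [0, 1, 2, 5, 3, 4, 6, 7]),
  (1, 1, 3, 4, 2, [1, 0, 2, 3, 4, 5, 6, 7]),
  (1, 1, 3, 5, 2, [1, 0, 2, 3, 5, 4, 6, 7]),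
  (1, 1, 4, 5, 2, [1, 0, 2, 5, 3, 4, 6, 7]),
  (1, 2, 3, 4, 2, [1, 2, 0, 3, 4, 5, 6, 7]),
  (1, 2, 3, 5, 2, [1, 2, 0, 3, 5, 4, 6, 7]),
  (1, 2, 4, 5, 2, [1, 2, 0, 5, 3, 4, 6, 7]),
  (1, 3, 4, 5, 3, [3, 4, 5, 0, 1, 2, 7, 6]),
  (2, 1, 3, 5, 4, [8, 6, 4, 7, 2, 5, 1, 3, 0]),
  (2, 1, 4, 5, 4, [7, 6, 5, 2, 8, 4, 0, 3, 1]),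
  (2, 2, 3, 5, 4, [6, 4, 8, 7, 5, 2, 1, 0, 3]),
  (2, 2, 4, 5, 4, [3, 4, 0, 5, 1, 2, 7, 8, 6]),
  (4, 2, 4, 5, 6, [1, 3, 5, 9, 7, 6, 8, 4, 2, 0]),
  (5, 0, 2, 4, 2, [6, 3, 7, 1, 5, 2, 4, 0]),
  (5, 0, 3, 4, 2, [6, 3, 1, 7, 5, 2, 4, 0]),
  (5, 0, 4, 5, 2, [6, 3, 1, 2, 5, 7, 4, 0]),
  (5, 1, 2, 4, 2, [1, 7, 6, 3, 5, 4, 2, 0]),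
  (5, 1, 3, 4, 2, [1, 7, 3, 6, 5, 4, 2, 0]),
  (5, 1, 4, 5, 2, [1, 7, 3, 4, 5, 6, 2, 0]),
  (5, 2, 4, 6, 2, [1, 2, 6, 3, 5, 4, 7, 0]),
  (5, 3, 4, 6, 2, [1, 2, 3, 6, 5, 4, 7, 0]),
  (5, 4, 5, 6, 2, [1, 2, 3, 4, 5, 6, 7, 0]),
  (1, 3, 4, 5, 3, [0, 1, 2, 3, 4, 5, 6, 7]),
  (2, 1, 3, 5, 4, [1, 0, 2, 3, 5, 4, 6, 8, 7]),
  (2, 1, 3, 5, 4, [0, 1, 2, 3, 4, 5, 6, 7, 8]),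
  (4, 2, 4, 5, 6, [0, 3, 4, 9, 8, 6, 7, 5, 2, 1]),
  (4, 2, 4, 5, 6, [0, 4, 3, 8, 9, 6, 7, 5, 1, 2]),
  (4, 2, 4, 5, 6, [0, 1, 2, 9, 8, 7, 6, 5, 4, 3]),
  (4, 2, 4, 5, 6, [0, 2, 1, 8, 9, 7, 6, 5, 3, 4]),
  (4, 2, 4, 5, 6, [1, 2, 0, 7, 9, 8, 6, 4, 3, 5]),
  (4, 2, 4, 5, 6, [3, 4, 0, 5, 1, 2, 7, 8, 9, 6]),
  (4, 2, 4, 5, 6, [1, 2, 0, 5, 3, 4, 6, 8, 9, 7]),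
  (4, 2, 4, 5, 6, [0, 2, 1, 4, 3, 5, 6, 7, 9, 8]),
  (4, 2, 4, 5, 6, [0, 1, 2, 3, 4, 5, 6, 7, 8, 9])]

/-- Membership in a triple. -/
def T (a b c u : ℕ) : Bool := Nat.beq u a || Nat.beq u b || Nat.beq u c

/-- Adjacency after a move. -/
def TY (j : Fin 7) (a b c u v : ℕ) : Bool :=
  if Nat.beq u (sz j) then T a b c v
  else if Nat.beq v (sz j) then T a b c u
  else A j u v && !(T a b c u && T a b c v)

/-- An arrow is correct. -/
def valid : Arrow → Bool
  | (j, a, b, c, i, s) =>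
    Nat.blt a (sz j) && Nat.blt b (sz j) && Nat.blt c (sz j) &&
    A j a b && A j b c && A j a c && Nat.beq (sz i) (sz j + 1) &&
    (List.range (sz i)).all (fun u => Nat.blt (s.getD u 0) (sz i) &&
      (List.range (sz i)).all (fun v =>
        (Nat.beq u v || !(Nat.beq (s.getD u 0) (s.getD v 0))) &&
        (TY j a b c u v == A i (s.getD u 0) (s.getD v 0))))

theorem arrows_valid : arrows.all valid = true := by decide +kernel

theorem deltaY_check : ((List.finRange 7).all fun j =>
    (List.range (sz j)).all fun a => (List.range (sz j)).all fun b => !A j a b ||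
      (List.range (sz j)).all fun c => !(A j b c && A j a c) ||
        arrows.any fun t => t.1 == j &&
          (List.range (sz j)).all fun u => T a b c u == T t.2.1 t.2.2.1 t.2.2.2.1 u) = true := by
  decide +kernel

theorem yDelta_check : ((List.finRange 7).all fun i =>
    (List.range (sz i)).all fun v => (arrows.any fun t => t.2.2.2.2.1 == i &&
        Nat.beq (t.2.2.2.2.2.getD (sz t.1) 0) v) ||
      (List.range (sz i)).all fun p => !A i v p ||
      (List.range (sz i)).all fun q => !A i v q ||
      (List.range (sz i)).all fun r => !A i v r ||
      !((List.range (sz i)).all fun u => A i v u == T p q r u)) = true := by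
  decide +kernel

/-- One round of the search in graph `i` without `p` and `q`. -/
def step (i : Fin 7) (p q : ℕ) (S : List ℕ) : List ℕ :=
  (List.range (sz i)).filter fun w => S.contains w ||
    (!(Nat.beq w p) && !(Nat.beq w q) && S.any fun u => A i u w)

/-- The vertices other than `p` and `q`. -/
def others (i : Fin 7) (p q : ℕ) : List ℕ :=
  (List.range (sz i)).filter fun w => !(Nat.beq w p) && !(Nat.beq w q)

theorem conn_check : ((List.finRange 7).all fun i =>
    (List.range (sz i + 1)).all fun p => (List.range (sz i + 1)).all fun q =>
      (others i p q).all fun w =>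
        ((step i p q)^[6] ((others i p q).take 1)).contains w) = true := by
  decide +kernel

end PF

/-! ### Every graph of the Petersen family is one of the seven graphs -/

theorem triangleY_some_some {V : Type} (G : SimpleGraph V) {a b c : V} (u v : V) :
    (triangleY G a b c).Adj (some u) (some v) ↔
      G.Adj u v ∧ ¬ ((u = a ∨ u = b ∨ u = c) ∧ (v = a ∨ v = b ∨ v = c)) := by
  have h : ∀ p q : V, (triangleY G a b c).Adj (some p) (some q) ↔
      G.Adj p q ∧ s(p, q) ∉ ({s(a, b), s(b, c), s(a, c)} : Set (Sym2 V)) := by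
    intro p q
    have h0 : (SimpleGraph.map Function.Embedding.some
        (G.deleteEdges {s(a, b), s(b, c), s(a, c)})).Adj (some p) (some q) ↔
        (G.deleteEdges {s(a, b), s(b, c), s(a, c)}).Adj p q :=
      SimpleGraph.map_adj_apply (f := Function.Embedding.some)
    unfold triangleY
    rw [SimpleGraph.sup_adj, h0, SimpleGraph.deleteEdges_adj, SimpleGraph.fromEdgeSet_adj]
    simp
  rw [h]
  simp only [Set.mem_insert_iff, Set.mem_singleton_iff, Sym2.eq_iff]
  refine and_congr_right fun huv => ?_
  have := huv.ne
  grind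

theorem triangleY_none_some {V : Type} (G : SimpleGraph V) {a b c : V} (v : V) :
    (triangleY G a b c).Adj none (some v) ↔ (v = a ∨ v = b ∨ v = c) := by
  have h0 : ¬ (SimpleGraph.map Function.Embedding.some
      (G.deleteEdges {s(a, b), s(b, c), s(a, c)})).Adj none (some v) := by
    rw [SimpleGraph.map_adj]
    rintro ⟨p, q, -, hp, -⟩
    exact Option.some_ne_none p hp
  unfold triangleY
  rw [SimpleGraph.sup_adj, SimpleGraph.fromEdgeSet_adj]
  simp only [h0, false_or]
  simp

theorem triangleY_iso_none {V W : Type} {G : SimpleGraph V} {H : SimpleGraph W} {a b c : V}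
    {a' b' c' : W} (hab : G.Adj a b) (hbc : G.Adj b c) (hac : G.Adj a c)
    (hab' : H.Adj a' b') (hbc' : H.Adj b' c') (hac' : H.Adj a' c')
    (e : triangleY G a b c ≃g triangleY H a' b' c') (he : e none = none) :
    Nonempty (G ≃g H) := by
  have hs : ∀ u, some (Equiv.removeNone e.toEquiv u) = e (some u) := by
    intro u
    refine Equiv.removeNone_some e.toEquiv (Option.ne_none_iff_exists'.1 ?_)
    intro h
    have : e (some u) = e none := h.trans he.symm
    exact Option.some_ne_none u (e.injective this)
  have hT : ∀ u, (u = a ∨ u = b ∨ u = c) ↔ (Equiv.removeNone e.toEquiv u = a' ∨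
      Equiv.removeNone e.toEquiv u = b' ∨ Equiv.removeNone e.toEquiv u = c') := by
    intro u
    rw [← triangleY_none_some G, ← triangleY_none_some H, hs, ← e.map_adj_iff, he]
  refine ⟨⟨Equiv.removeNone e.toEquiv, ?_⟩⟩
  intro u v
  have h1 := e.map_adj_iff (v := some u) (w := some v)
  rw [← hs, ← hs, triangleY_some_some, triangleY_some_some, ← hT, ← hT] at h1
  have key : ∀ {X : Type} (K : SimpleGraph X) (a b c : X), K.Adj a b → K.Adj b c → K.Adj a c →
      ∀ u v, (u = a ∨ u = b ∨ u = c) → (v = a ∨ v = b ∨ v = c) → (K.Adj u v ↔ u ≠ v) := by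
    intro X K a b c h1 h2 h3 u v hu hv
    have h1' := h1.symm
    have h2' := h2.symm
    have h3' := h3.symm
    constructor
    · exact fun h => h.ne
    · intro h
      rcases hu with rfl | rfl | rfl <;> rcases hv with rfl | rfl | rfl <;>
        first | assumption | exact absurd rfl h
  by_cases hu : (u = a ∨ u = b ∨ u = c) ∧ (v = a ∨ v = b ∨ v = c)
  · rw [key G a b c hab hbc hac u v hu.1 hu.2,
      key H a' b' c' hab' hbc' hac' _ _ ((hT u).1 hu.1) ((hT v).1 hu.2)]
    exact (Equiv.removeNone e.toEquiv).injective.ne_iff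
  · simpa [hu] using h1

theorem triangleY_congr {V : Type} (G : SimpleGraph V) {a b c a' b' c' : V}
    (h : ∀ u, (u = a ∨ u = b ∨ u = c) ↔ (u = a' ∨ u = b' ∨ u = c')) :
    triangleY G a b c = triangleY G a' b' c' := by
  ext u v
  rcases u with _ | u <;> rcases v with _ | v
  · simp
  · rw [triangleY_none_some, triangleY_none_some, h]
  · rw [SimpleGraph.adj_comm, triangleY_none_some, SimpleGraph.adj_comm, triangleY_none_some, h]
  · rw [triangleY_some_some, triangleY_some_some, h, h]

theorem triangleY_iso {V W : Type} {G : SimpleGraph V} {H : SimpleGraph W} (e : G ≃g H)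
    (a b c : V) : Nonempty (triangleY G a b c ≃g triangleY H (e a) (e b) (e c)) := by
  refine ⟨⟨Equiv.optionCongr e.toEquiv, ?_⟩⟩
  have hT : ∀ u, (e u = e a ∨ e u = e b ∨ e u = e c) ↔ (u = a ∨ u = b ∨ u = c) := by
    intro u; simp
  intro u v
  rcases u with _ | u <;> rcases v with _ | v
  · simp
  · change (triangleY H _ _ _).Adj none (some (e v)) ↔ _
    rw [triangleY_none_some, triangleY_none_some, hT]
  · change (triangleY H _ _ _).Adj (some (e u)) none ↔ _
    rw [SimpleGraph.adj_comm, triangleY_none_some, SimpleGraph.adj_comm, triangleY_none_some, hT]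
  · change (triangleY H _ _ _).Adj (some (e u)) (some (e v)) ↔ _
    rw [triangleY_some_some, triangleY_some_some, hT, hT, e.map_adj_iff]

namespace PF

theorem T_iff (a b c u : ℕ) : T a b c u = true ↔ (u = a ∨ u = b ∨ u = c) := by
  simp [T, or_assoc]

theorem arrow_iso {j i : Fin 7} {a b c : ℕ} {s : List ℕ} (h : (j, a, b, c, i, s) ∈ arrows) :
    ∃ (a' b' c' : Fin (sz j)), a'.val = a ∧ b'.val = b ∧ c'.val = c ∧
      (gr j).Adj a' b' ∧ (gr j).Adj b' c' ∧ (gr j).Adj a' c' ∧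
      ∃ e : triangleY (gr j) a' b' c' ≃g gr i, (e none).val = s.getD (sz j) 0 := by
  have hv := List.all_eq_true.1 arrows_valid _ h
  simp only [valid, Bool.and_eq_true, Nat.blt_eq, Nat.beq_eq, List.all_eq_true, List.mem_range,
    Bool.or_eq_true, Bool.not_eq_true', beq_iff_eq] at hv
  obtain ⟨⟨⟨⟨⟨⟨⟨ha, hb⟩, hc⟩, hab⟩, hbc⟩, hac⟩, hsz⟩, hs⟩ := hv
  refine ⟨⟨a, ha⟩, ⟨b, hb⟩, ⟨c, hc⟩, rfl, rfl, rfl, hab, hbc, hac, ?_⟩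
  let k : Option (Fin (sz j)) → ℕ := fun o => o.elim (sz j) (fun u => u.val)
  have hk : ∀ o, k o < sz i := by
    rintro (_ | u)
    · change sz j < sz i
      omega
    · change u.val < sz i
      have := u.2
      omega
  have hkinj : Function.Injective k := by
    rintro (_ | u) (_ | v) huv
    · rfl
    · change sz j = v.val at huv
      have := v.2
      omega
    · change u.val = sz j at huv
      have := u.2
      omega
    · change u.val = v.val at huv
      rw [Fin.ext huv]
  let f : Option (Fin (sz j)) → Fin (sz i) := fun o => ⟨s.getD (k o) 0, (hs _ (hk o)).1⟩
  have hf : Function.Injective f := by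
    intro o o' hoo
    have h1 : s.getD (k o) 0 = s.getD (k o') 0 := congrArg Fin.val hoo
    rcases ((hs _ (hk o)).2 _ (hk o')).1 with h2 | h2
    · exact hkinj h2
    · rw [h1] at h2
      simp at h2
  have hbij : Function.Bijective f :=
    (Fintype.bijective_iff_injective_and_card f).2 ⟨hf, by simp [hsz]⟩
  have hadj : ∀ o o', (gr i).Adj (f o) (f o') ↔ TY j a b c (k o) (k o') = true := by
    intro o o'
    rw [((hs _ (hk o)).2 _ (hk o')).2]
    rfl
  have hne : ∀ u : Fin (sz j), Nat.beq u (sz j) = false := by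
    intro u
    have := u.2
    rw [← Bool.not_eq_true, Nat.beq_eq]
    omega
  have hE : ∀ u x : Fin (sz j), (u = x) ↔ (u.val = x.val) := fun u x => Fin.ext_iff
  have hns : ∀ v : Fin (sz j), (gr i).Adj (f none) (f (some v)) ↔
      (triangleY (gr j) ⟨a, ha⟩ ⟨b, hb⟩ ⟨c, hc⟩).Adj none (some v) := by
    intro v
    rw [hadj, triangleY_none_some]
    change TY j a b c (sz j) v = true ↔ _
    simp only [TY, Nat.beq_refl, if_true, T_iff, hE]
  refine ⟨⟨Equiv.ofBijective f hbij, ?_⟩, rfl⟩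
  intro o o'
  change (gr i).Adj (f o) (f o') ↔ _
  rcases o with _ | u <;> rcases o' with _ | v
  · simp
  · exact hns v
  · rw [SimpleGraph.adj_comm, hns, SimpleGraph.adj_comm]
  · rw [hadj, triangleY_some_some]
    change TY j a b c u v = true ↔ (A j u v = true ∧ _)
    simp only [TY, hne, hE, ← T_iff]
    cases T a b c u <;> cases T a b c v <;> simp

theorem deltaY_closed (j : Fin 7) (a b c : Fin (sz j)) (hab : (gr j).Adj a b)
    (hbc : (gr j).Adj b c) (hac : (gr j).Adj a c) :
    ∃ i, Nonempty (triangleY (gr j) a b c ≃g gr i) := by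
  have h := deltaY_check
  simp only [List.all_eq_true, List.mem_range, Bool.or_eq_true, Bool.not_eq_true',
    List.any_eq_true, Bool.and_eq_true, beq_iff_eq] at h
  have h1 := h j (List.mem_finRange j) a a.2 b b.2
  have e1 : A j a b = true := hab
  have e2 : A j b c = true := hbc
  have e3 : A j a c = true := hac
  rw [e1] at h1
  have h2 := (h1.resolve_left (by simp)) c c.2
  rw [e2, e3] at h2
  obtain ⟨⟨j', a', b', c', i, s⟩, ht, rfl, hu⟩ := h2.resolve_left (by simp)
  obtain ⟨a1, b1, c1, ha, hb, hc, -, -, -, e, -⟩ := arrow_iso ht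
  refine ⟨i, ⟨?_⟩⟩
  rw [triangleY_congr (gr _) (a' := a1) (b' := b1) (c' := c1)]
  · exact e
  · intro u
    have := hu u u.2
    simp only [Fin.ext_iff, ha, hb, hc, ← T_iff]
    rw [this]

theorem yDelta_closed {V : Type} (G : SimpleGraph V) (i : Fin 7) (a b c : V) (hab : G.Adj a b)
    (hbc : G.Adj b c) (hac : G.Adj a c) (e : triangleY G a b c ≃g gr i) :
    ∃ j, Nonempty (G ≃g gr j) := by
  have h := yDelta_check
  simp only [List.all_eq_true, List.mem_range, Bool.or_eq_true, Bool.not_eq_true',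
    List.any_eq_true, Bool.and_eq_true, beq_iff_eq, Nat.beq_eq] at h
  have hn : ∀ u, A i (e none) (e u) = true ↔ (triangleY G a b c).Adj none u := fun u =>
    e.map_adj_iff
  have hn' : ∀ u, A i (e none) (e (some u)) = true ↔ (u = a ∨ u = b ∨ u = c) := fun u => by
    rw [hn, triangleY_none_some]
  have : ∃ t ∈ arrows, t.2.2.2.2.1 = i ∧ t.2.2.2.2.2.getD (sz t.1) 0 = (e none).val := by
    rcases h i (List.mem_finRange i) (e none) (e none).2 with h1 | h1
    · exact h1
    · exfalso
      have h2 := ((h1 _ (e (some a)).2).resolve_left (by rw [(hn' a).2 (by simp)]; simp))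
      have h3 := ((h2 _ (e (some b)).2).resolve_left (by rw [(hn' b).2 (by simp)]; simp))
      have h4 := ((h3 _ (e (some c)).2).resolve_left (by rw [(hn' c).2 (by simp)]; simp))
      rw [← Bool.not_eq_true, List.all_eq_true] at h4
      apply h4
      intro u hu
      rw [List.mem_range] at hu
      obtain ⟨o, ho⟩ := e.surjective ⟨u, hu⟩
      have ho' : u = (e o).val := by rw [ho]
      rw [beq_iff_eq, Bool.eq_iff_iff, ho', hn, T_iff]
      simp only [← Fin.ext_iff, e.injective.eq_iff]
      rcases o with _ | o
      · simp
      · rw [triangleY_none_some]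
        simp
  obtain ⟨⟨j, a', b', c', i', s⟩, ht, rfl, hs⟩ := this
  obtain ⟨a1, b1, c1, ha, hb, hc, h1, h2, h3, e', he'⟩ := arrow_iso ht
  refine ⟨j, triangleY_iso_none hab hbc hac h1 h2 h3 (e.trans e'.symm) ?_⟩
  have : e none = e' none := by
    apply Fin.ext
    rw [he', ← hs]
  change e'.symm (e none) = none
  rw [this]
  exact e'.symm_apply_apply none

theorem classify {V : Type} {P : SimpleGraph V} (h : IsPetersenFamily P) :
    ∃ i, Nonempty (P ≃g gr i) := by
  induction h with
  | k6 =>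
    refine ⟨0, ⟨⟨Equiv.refl (Fin 6), ?_⟩⟩⟩
    have : ∀ u v : Fin 6, A 0 u v = true ↔ u ≠ v := by decide +kernel
    intro u v
    exact this u v
  | @deltaY V G a b c _ hab hbc hac ih =>
    obtain ⟨i, ⟨e⟩⟩ := ih
    obtain ⟨e1⟩ := triangleY_iso e a b c
    obtain ⟨k, ⟨e2⟩⟩ := deltaY_closed i (e a) (e b) (e c) (e.map_adj_iff.2 hab)
      (e.map_adj_iff.2 hbc) (e.map_adj_iff.2 hac)
    exact ⟨k, ⟨e1.trans e2⟩⟩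
  | @yDelta V G a b c _ hab hbc hac ih =>
    obtain ⟨i, ⟨e⟩⟩ := ih
    exact yDelta_closed G i a b c hab hbc hac e
  | iso _ e ih =>
    obtain ⟨i, ⟨e1⟩⟩ := ih
    exact ⟨i, ⟨e.symm.trans e1⟩⟩

end PF

/-- Removing at most two vertices leaves a connected graph, stated through colourings. -/
def ThreeConn {W : Type} (P : SimpleGraph W) : Prop :=
  ∀ (p q : Option W) (c : W → Prop),
    (∀ u v, some u ≠ p → some u ≠ q → some v ≠ p → some v ≠ q → P.Adj u v → c u → c v) →
    ∀ u v, some u ≠ p → some u ≠ q → some v ≠ p → some v ≠ q → c u → c v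

theorem ThreeConn.of_iso {W W' : Type} {P : SimpleGraph W} {P' : SimpleGraph W'} (e : P ≃g P')
    (h : ThreeConn P') : ThreeConn P := by
  intro p q c hc u v hup huq hvp hvq hcu
  have hm : ∀ (u : W) (p : Option W), some u ≠ p → some (e u) ≠ p.map e := by
    intro u p hup h
    apply hup
    rw [← Option.map_some] at h
    exact Option.map_injective e.injective h
  have hm' : ∀ (u : W') (p : Option W), some u ≠ p.map e → some (e.symm u) ≠ p := by
    intro u p hup h
    apply hup
    rw [← h]
    simp
  have := h (p.map e) (q.map e) (fun w => c (e.symm w)) ?_ (e u) (e v) (hm _ _ hup) (hm _ _ huq)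
    (hm _ _ hvp) (hm _ _ hvq) (by simpa using hcu)
  · simpa using this
  · intro u v h1 h2 h3 h4 h5
    exact hc _ _ (hm' _ _ h1) (hm' _ _ h2) (hm' _ _ h3) (hm' _ _ h4) (e.symm.map_adj_iff.2 h5)

namespace PF

theorem gr_threeConn (i : Fin 7) : ThreeConn (gr i) := by
  intro p q c hc
  let k : Option (Fin (sz i)) → ℕ := fun o => o.elim (sz i) (fun u => u.val)
  have hk : ∀ o, k o < sz i + 1 := by
    rintro (_ | u)
    · exact Nat.lt_succ_self _
    · exact Nat.lt_succ_of_lt u.2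
  have hkn : ∀ (u : Fin (sz i)) (o : Option (Fin (sz i))), u.val ≠ k o ↔ some u ≠ o := by
    rintro u (_ | v)
    · have := u.2
      change u.val ≠ sz i ↔ _
      simp
      omega
    · change u.val ≠ v.val ↔ _
      simp [Fin.ext_iff]
  have h := conn_check
  simp only [List.all_eq_true, List.mem_range, List.contains_iff_mem] at h
  have h1 := h i (List.mem_finRange i) _ (hk p) _ (hk q)
  have hmem : ∀ w, w ∈ others i (k p) (k q) ↔ w < sz i ∧ w ≠ k p ∧ w ≠ k q := by
    intro w
    simp [others, ← Bool.not_eq_true]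
  -- all the vertices found have the same colour
  let good : ℕ → Prop → Prop := fun w b =>
    ∃ hw : w < sz i, w ≠ k p ∧ w ≠ k q ∧ (c ⟨w, hw⟩ ↔ b)
  have hstep : ∀ S b, (∀ w ∈ S, good w b) → ∀ w ∈ step i (k p) (k q) S, good w b := by
    intro S b hS w hw
    simp only [step, List.mem_filter, List.mem_range, Bool.or_eq_true, List.contains_iff_mem,
      Bool.and_eq_true, Bool.not_eq_true', List.any_eq_true, ← Bool.not_eq_true, Nat.beq_eq] at hw
    obtain ⟨hw, h2 | ⟨⟨h2, h3⟩, u, hu, hA⟩⟩ := hw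
    · exact hS w h2
    · obtain ⟨hu1, hu2, hu3, hu4⟩ := hS u hu
      refine ⟨hw, h2, h3, ?_⟩
      rw [← hu4]
      have hadj : (gr i).Adj ⟨u, hu1⟩ ⟨w, hw⟩ := hA
      have a1 := (hkn ⟨u, hu1⟩ p).1 hu2
      have a2 := (hkn ⟨u, hu1⟩ q).1 hu3
      have a3 := (hkn ⟨w, hw⟩ p).1 h2
      have a4 := (hkn ⟨w, hw⟩ q).1 h3
      exact ⟨hc _ _ a3 a4 a1 a2 hadj.symm, hc _ _ a1 a2 a3 a4 hadj⟩
  have hiter : ∀ n S b, (∀ w ∈ S, good w b) → ∀ w ∈ (step i (k p) (k q))^[n] S, good w b := by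
    intro n
    induction n with
    | zero => exact fun S b h => h
    | succ n ih =>
      intro S b hS
      rw [Function.iterate_succ_apply]
      exact ih _ b (hstep S b hS)
  have hstart : ∃ b, ∀ w ∈ (others i (k p) (k q)).take 1, good w b := by
    cases hl : others i (k p) (k q) with
    | nil => exact ⟨True, by simp⟩
    | cons z l =>
      have hz := (hmem z).1 (by rw [hl]; simp)
      refine ⟨c ⟨z, hz.1⟩, ?_⟩
      intro w hw
      simp at hw
      subst hw
      exact ⟨hz.1, hz.2.1, hz.2.2, Iff.rfl⟩
  obtain ⟨b, hb⟩ := hstart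
  have hall := hiter 6 _ b hb
  intro u v hup huq hvp hvq hcu
  obtain ⟨_, _, _, g1⟩ := hall _ (h1 u ((hmem u).2 ⟨u.2, (hkn u p).2 hup, (hkn u q).2 huq⟩))
  obtain ⟨_, _, _, g2⟩ := hall _ (h1 v ((hmem v).2 ⟨v.2, (hkn v p).2 hvp, (hkn v q).2 hvq⟩))
  exact g2.2 (g1.1 hcu)

end PF

theorem IsPetersenFamily.threeConn {W : Type} {P : SimpleGraph W} (h : IsPetersenFamily P) :
    ThreeConn P := by
  obtain ⟨i, ⟨e⟩⟩ := PF.classify h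
  exact (PF.gr_threeConn i).of_iso e

theorem IsPetersenFamily.card {W : Type} {P : SimpleGraph W} (h : IsPetersenFamily P) :
    6 ≤ Nat.card W := by
  obtain ⟨i, ⟨e⟩⟩ := PF.classify h
  rw [Nat.card_congr e.toEquiv, Nat.card_fin]
  revert i
  have : ∀ i, 6 ≤ PF.sz i := by decide
  exact fun i _ => this i

/-! ### Minors inside a vertex set -/

/-- `T` is a nonempty set inducing a connected subgraph of `G`. -/
def Conn {V : Type} (G : SimpleGraph V) (T : Set V) : Prop :=
  T.Nonempty ∧ ∀ Q : Set V, (∃ t ∈ T, t ∈ Q) →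
    (∀ u ∈ T, ∀ v ∈ T, G.Adj u v → u ∈ Q → v ∈ Q) → T ⊆ Q

theorem conn_iff {V : Type} (G : SimpleGraph V) (T : Set V) :
    (G.induce T).Connected ↔ Conn G T := by
  constructor
  · intro h
    refine ⟨Set.nonempty_coe_sort.1 h.nonempty, ?_⟩
    rintro Q ⟨t, ht, htQ⟩ hQ v hv
    obtain ⟨w⟩ := h.preconnected ⟨t, ht⟩ ⟨v, hv⟩
    have : ∀ (a b : T), (G.induce T).Walk a b → a.val ∈ Q → b.val ∈ Q := by
      intro a b w
      induction w with
      | nil => exact id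
      | cons hadj _ ih => exact fun ha => ih (hQ _ (Subtype.property _) _ (Subtype.property _) hadj ha)
    exact this _ _ w htQ
  · rintro ⟨hne, h⟩
    have : Nonempty T := hne.coe_sort
    refine ⟨?_⟩
    rintro ⟨u, hu⟩ ⟨v, hv⟩
    have := h {w | ∃ hw : w ∈ T, (G.induce T).Reachable ⟨u, hu⟩ ⟨w, hw⟩}
      ⟨u, hu, hu, Reachable.refl _⟩ ?_ hv
    · exact this.2
    · rintro a ha b hb hab ⟨_, hr⟩
      refine ⟨hb, hr.trans (Adj.reachable ?_)⟩
      exact hab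

/-- `P` is a minor of `G` with all branch sets inside `S`. -/
def MIn {W V : Type} (P : SimpleGraph W) (G : SimpleGraph V) (S : Set V) : Prop :=
  ∃ f : W → Set V, (∀ w, f w ⊆ S) ∧ (∀ w, Conn G (f w)) ∧
    (∀ w₁ w₂ v, v ∈ f w₁ → v ∈ f w₂ → w₁ = w₂) ∧
    ∀ w₁ w₂, P.Adj w₁ w₂ → ∃ v₁ ∈ f w₁, ∃ v₂ ∈ f w₂, G.Adj v₁ v₂

theorem isMinor_iff {W V : Type} (P : SimpleGraph W) (G : SimpleGraph V) :
    IsMinor P G ↔ MIn P G Set.univ := by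
  constructor
  · rintro ⟨f, h1, h2, h3, h4⟩
    refine ⟨f, fun w => Set.subset_univ _, fun w => (conn_iff _ _).1 (h2 w), ?_, fun _ _ h => h4 h⟩
    intro w₁ w₂ v hv1 hv2
    by_contra hne
    exact Set.disjoint_left.1 (h3 hne) hv1 hv2
  · rintro ⟨f, -, h2, h3, h4⟩
    refine ⟨f, fun w => (h2 w).1, fun w => (conn_iff _ _).2 (h2 w), ?_, fun _ _ h => h4 _ _ h⟩
    intro w₁ w₂ hne
    exact Set.disjoint_left.2 fun v hv1 hv2 => hne (h3 _ _ v hv1 hv2)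

theorem Conn.mono {V : Type} {G G' : SimpleGraph V} {T : Set V} (h : Conn G T)
    (hG : ∀ u ∈ T, ∀ v ∈ T, G.Adj u v → G'.Adj u v) : Conn G' T :=
  ⟨h.1, fun Q hQ hc => h.2 Q hQ fun u hu v hv huv => hc u hu v hv (hG u hu v hv huv)⟩

theorem MIn.mono {W V : Type} {P : SimpleGraph W} {G G' : SimpleGraph V} {S S' : Set V}
    (h : MIn P G S) (hS : S ⊆ S') (hG : ∀ u ∈ S, ∀ v ∈ S, G.Adj u v → G'.Adj u v) :
    MIn P G' S' := by
  obtain ⟨f, h1, h2, h3, h4⟩ := h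
  refine ⟨f, fun w => (h1 w).trans hS, fun w => (h2 w).mono fun u hu v hv =>
    hG u (h1 w hu) v (h1 w hv), h3, ?_⟩
  intro w₁ w₂ hw
  obtain ⟨v₁, hv₁, v₂, hv₂, hv⟩ := h4 _ _ hw
  exact ⟨v₁, hv₁, v₂, hv₂, hG _ (h1 _ hv₁) _ (h1 _ hv₂) hv⟩

theorem conn_induce {V : Type} (G : SimpleGraph V) (S : Set V) (T : Set S) :
    Conn (G.induce S) T ↔ Conn G (Subtype.val '' T) := by
  constructor
  · rintro ⟨h1, h2⟩
    refine ⟨h1.image _, ?_⟩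
    rintro Q ⟨_, ⟨t, ht, rfl⟩, htQ⟩ hQ _ ⟨v, hv, rfl⟩
    exact h2 (Subtype.val ⁻¹' Q) ⟨t, ht, htQ⟩
      (fun a ha b hb hab haQ => hQ _ ⟨a, ha, rfl⟩ _ ⟨b, hb, rfl⟩ hab haQ) hv
  · rintro ⟨h1, h2⟩
    refine ⟨h1.of_image, ?_⟩
    rintro Q ⟨t, ht, htQ⟩ hQ v hv
    have := h2 (Subtype.val '' Q) ⟨t, ⟨t, ht, rfl⟩, ⟨t, htQ, rfl⟩⟩ ?_ ⟨v, hv, rfl⟩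
    · obtain ⟨v', hv', he⟩ := this
      rwa [← Subtype.ext he]
    · rintro _ ⟨a, ha, rfl⟩ _ ⟨b, hb, rfl⟩ hab ⟨a', ha', he⟩
      rw [Subtype.ext he] at ha'
      exact ⟨b, hQ a ha b hb hab ha', rfl⟩

theorem isMinor_induce_iff {W V : Type} (P : SimpleGraph W) (G : SimpleGraph V) (S : Set V) :
    IsMinor P (G.induce S) ↔ MIn P G S := by
  rw [isMinor_iff]
  constructor
  · rintro ⟨f, -, h2, h3, h4⟩
    refine ⟨fun w => Subtype.val '' f w, ?_, fun w => (conn_induce _ _ _).1 (h2 w), ?_, ?_⟩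
    · rintro w _ ⟨v, -, rfl⟩
      exact v.2
    · rintro w₁ w₂ _ ⟨v, hv, rfl⟩ ⟨v', hv', he⟩
      rw [Subtype.ext he] at hv'
      exact h3 _ _ v hv hv'
    · intro w₁ w₂ hw
      obtain ⟨v₁, hv₁, v₂, hv₂, hv⟩ := h4 _ _ hw
      exact ⟨v₁, ⟨v₁, hv₁, rfl⟩, v₂, ⟨v₂, hv₂, rfl⟩, hv⟩
  · rintro ⟨f, h1, h2, h3, h4⟩
    refine ⟨fun w => Subtype.val ⁻¹' f w, fun w => Set.subset_univ _, ?_, ?_, ?_⟩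
    · intro w
      rw [conn_induce, Subtype.image_preimage_coe, Set.inter_eq_right.2 (h1 w)]
      exact h2 w
    · intro w₁ w₂ v hv1 hv2
      exact h3 _ _ _ hv1 hv2
    · intro w₁ w₂ hw
      obtain ⟨v₁, hv₁, v₂, hv₂, hv⟩ := h4 _ _ hw
      exact ⟨⟨v₁, h1 _ hv₁⟩, hv₁, ⟨v₂, h1 _ hv₂⟩, hv₂, hv⟩

theorem MIn.card_le {W V : Type} {P : SimpleGraph W} {G : SimpleGraph V} {S : Set V}
    (h : MIn P G S) (hS : S.Finite) : Nat.card W ≤ S.ncard := by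
  obtain ⟨f, h1, h2, h3, -⟩ := h
  choose g hg using fun w => (h2 w).1
  have := hS.to_subtype
  rw [← Nat.card_coe_set_eq]
  refine Nat.card_le_card_of_injective (fun w => (⟨g w, h1 w (hg w)⟩ : S)) ?_
  intro w w' hw
  have : g w = g w' := congrArg Subtype.val hw
  exact h3 _ _ _ (hg w) (this ▸ hg w')

/-- If all branch sets avoiding the edge `s t` are on the side `A`, the other side is not needed. -/
theorem side {W V : Type} {P : SimpleGraph W} {G : SimpleGraph V} {s t : V} (hst : G.Adj s t)
    {A B : Set V} (hAB : ∀ u ∈ A, ∀ v ∈ B, ¬ G.Adj u v) {f : W → Set V}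
    (hf : ∀ w, f w ⊆ A ∪ B ∪ {s, t})
    (hs : ∀ w, s ∉ f w → t ∉ f w → f w ⊆ A)
    (h2 : ∀ w, Conn G (f w)) (h3 : ∀ w₁ w₂ v, v ∈ f w₁ → v ∈ f w₂ → w₁ = w₂)
    (h4 : ∀ w₁ w₂, P.Adj w₁ w₂ → ∃ v₁ ∈ f w₁, ∃ v₂ ∈ f w₂, G.Adj v₁ v₂) :
    MIn P G (A ∪ {s, t}) := by
  have hst' := hst.symm
  have hf' : ∀ w v, v ∈ f w → v ∈ A ∨ v ∈ B ∨ v = s ∨ v = t := by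
    intro w v hv
    have := hf w hv
    simp at this
    tauto
  refine ⟨fun w => f w ∩ (A ∪ {s, t}), fun w => Set.inter_subset_right, ?_, ?_, ?_⟩
  · intro w
    refine ⟨?_, ?_⟩
    · by_cases h1 : s ∈ f w
      · exact ⟨s, h1, by simp⟩
      by_cases h1' : t ∈ f w
      · exact ⟨t, h1', by simp⟩
      obtain ⟨v, hv⟩ := (h2 w).1
      exact ⟨v, hv, Or.inl (hs w h1 h1' hv)⟩
    · rintro Q ⟨z, ⟨hz, hzA⟩, hzQ⟩ hQ
      have hQ' : ∀ u v, u ∈ f w → v ∈ f w → (u ∈ A ∨ u = s ∨ u = t) → (v ∈ A ∨ v = s ∨ v = t) →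
          G.Adj u v → u ∈ Q → v ∈ Q := by
        intro u v hu hv hu' hv' huv huQ
        exact hQ u ⟨hu, hu'⟩ v
          ⟨hv, hv'⟩ huv huQ
      have hzA' : z ∈ A ∨ z = s ∨ z = t := by
        simp at hzA
        tauto
      -- extend `Q` by the vertices of the other side, when it contains `s` or `t`
      by_cases hQs : (s ∈ f w ∧ s ∈ Q) ∨ (t ∈ f w ∧ t ∈ Q)
      · have hsQ : s ∈ f w → s ∈ Q := by
          rcases hQs with h | h
          · exact fun _ => h.2
          · exact fun h' => hQ' t s h.1 h' (by simp) (by simp) hst' h.2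
        have htQ : t ∈ f w → t ∈ Q := by
          rcases hQs with h | h
          · exact fun h' => hQ' s t h.1 h' (by simp) (by simp) hst h.2
          · exact fun _ => h.2
        have key := (h2 w).2 (Q ∪ {v | v ∉ A ∧ v ≠ s ∧ v ≠ t}) ⟨z, hz, Or.inl hzQ⟩ ?_
        · rintro v ⟨hv, hvA⟩
          rcases key hv with h | h
          · exact h
          · exfalso
            obtain ⟨h5, h6, h7⟩ := h
            simp at hvA
            tauto
        · intro u hu v hv huv huQ
          by_cases hvs : v = s
          · subst hvs
            exact Or.inl (hsQ hv)
          by_cases hvt : v = t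
          · subst hvt
            exact Or.inl (htQ hv)
          by_cases hvA : v ∈ A
          · left
            have huB : u ∉ B := fun h => hAB v hvA u h huv.symm
            have huA : u ∈ A ∨ u = s ∨ u = t := by
              have := hf' w u hu
              tauto
            rcases huQ with h | h
            · exact hQ' u v hu hv huA (Or.inl hvA) huv h
            · exfalso
              obtain ⟨h5, h6, h7⟩ := h
              tauto
          · exact Or.inr ⟨hvA, hvs, hvt⟩
      · push Not at hQs
        have hzA2 : z ∈ A := by
          rcases hzA' with h | rfl | rfl
          · exact h
          · exact absurd hzQ (hQs.1 hz)
          · exact absurd hzQ (hQs.2 hz)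
        have key := (h2 w).2 (Q ∩ A) ⟨z, hz, hzQ, hzA2⟩ ?_
        · exact fun v hv => (key hv.1).1
        · rintro u hu v hv huv ⟨huQ, huA⟩
          have hvB : v ∉ B := fun h => hAB u huA v h huv
          have hvA : v ∈ A ∨ v = s ∨ v = t := by
            have := hf' w v hv
            tauto
          have hvQ := hQ' u v hu hv (Or.inl huA) hvA huv huQ
          rcases hvA with h | rfl | rfl
          · exact ⟨hvQ, h⟩
          · exact absurd hvQ (hQs.1 hv)
          · exact absurd hvQ (hQs.2 hv)
  · intro w₁ w₂ v hv1 hv2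
    exact h3 _ _ v hv1.1 hv2.1
  · intro w₁ w₂ hw
    have hne := hw.ne
    by_cases ha : s ∈ f w₁ ∧ t ∈ f w₂
    · exact ⟨s, ⟨ha.1, by simp⟩, t, ⟨ha.2, by simp⟩, hst⟩
    by_cases hb : t ∈ f w₁ ∧ s ∈ f w₂
    · exact ⟨t, ⟨hb.1, by simp⟩, s, ⟨hb.2, by simp⟩, hst'⟩
    have hone : f w₁ ⊆ A ∨ f w₂ ⊆ A := by
      by_cases c1 : s ∈ f w₁
      · right
        exact hs _ (fun h => hne (h3 _ _ _ c1 h)) (fun h => ha ⟨c1, h⟩)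
      by_cases c2 : t ∈ f w₁
      · right
        exact hs _ (fun h => hb ⟨c2, h⟩) (fun h => hne (h3 _ _ _ c2 h))
      exact Or.inl (hs _ c1 c2)
    obtain ⟨v₁, hv₁, v₂, hv₂, hv⟩ := h4 _ _ hw
    have e1 := hf' _ _ hv₁
    have e2 := hf' _ _ hv₂
    have k1 : v₁ ∈ A ∨ v₁ = s ∨ v₁ = t := by
      rcases hone with h | h
      · exact Or.inl (h hv₁)
      · rcases e1 with e | e | e
        · exact Or.inl e
        · exact absurd hv.symm (hAB v₂ (h hv₂) v₁ e)
        · exact Or.inr e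
    have k2 : v₂ ∈ A ∨ v₂ = s ∨ v₂ = t := by
      rcases hone with h | h
      · rcases e2 with e | e | e
        · exact Or.inl e
        · exact absurd hv (hAB v₁ (h hv₁) v₂ e)
        · exact Or.inr e
      · exact Or.inl (h hv₂)
    exact ⟨v₁, ⟨hv₁, k1⟩, v₂, ⟨hv₂, k2⟩, hv⟩

/-- A 3-connected minor of a 2-sum is a minor of one of the summands. -/
theorem sum_lemma {W V : Type} {P : SimpleGraph W} (hP : ThreeConn P) {G : SimpleGraph V}
    {s t : V} (hst : G.Adj s t) {A B R : Set V} (hAB : ∀ u ∈ A, ∀ v ∈ B, ¬ G.Adj u v)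
    (hR : R ⊆ A ∪ B ∪ {s, t}) (h : MIn P G R) :
    MIn P G (A ∪ {s, t}) ∨ MIn P G (B ∪ {s, t}) := by
  obtain ⟨f, h1, h2, h3, h4⟩ := h
  have hf : ∀ w, f w ⊆ A ∪ B ∪ {s, t} := fun w => (h1 w).trans hR
  have hf' : ∀ w v, v ∈ f w → s ∉ f w → t ∉ f w → v ∈ A ∨ v ∈ B := by
    intro w v hv hs ht
    have := hf w hv
    rcases this with h | rfl | rfl
    · exact h
    · exact absurd hv hs
    · exact absurd hv ht
  -- the owner of a vertex
  have howner : ∀ x : V, ∃ p : Option W, ∀ w, some w ≠ p ↔ x ∉ f w := by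
    intro x
    by_cases hx : ∃ w, x ∈ f w
    · obtain ⟨w, hw⟩ := hx
      refine ⟨some w, fun w' => ?_⟩
      constructor
      · intro hne hx'
        exact hne (congrArg some (h3 _ _ _ hx' hw))
      · rintro hx' he
        rw [Option.some.inj he] at hx'
        exact hx' hw
    · push Not at hx
      exact ⟨none, fun w => by simp [hx w]⟩
  obtain ⟨p, hp⟩ := howner s
  obtain ⟨q, hq⟩ := howner t
  have hA : ∀ w, s ∉ f w → t ∉ f w → (f w ∩ A).Nonempty → f w ⊆ A := by
    rintro w hs ht ⟨z, hz, hzA⟩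
    refine (h2 w).2 A ⟨z, hz, hzA⟩ ?_
    intro u hu v hv huv huA
    exact (hf' w v hv hs ht).resolve_right fun hvB => hAB u huA v hvB huv
  have hcol := hP p q (fun w => (f w ∩ A).Nonempty) ?_
  · by_cases hex : ∃ w, s ∉ f w ∧ t ∉ f w ∧ (f w ∩ A).Nonempty
    · obtain ⟨w, hw1, hw2, hw3⟩ := hex
      left
      refine side hst hAB hf ?_ h2 h3 h4
      intro w' hw1' hw2'
      refine hA w' hw1' hw2' ?_
      exact hcol w w' ((hp w).2 hw1) ((hq w).2 hw2) ((hp w').2 hw1') ((hq w').2 hw2') hw3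
    · push Not at hex
      right
      refine side hst (A := B) (B := A) (fun u hu v hv huv => hAB v hv u hu huv.symm) ?_ ?_ h2 h3 h4
      · rw [Set.union_comm B A]
        exact hf
      · intro w hw1 hw2 v hv
        refine (hf' w v hv hw1 hw2).resolve_left fun hvA => ?_
        have := hex w hw1 hw2
        exact Set.notMem_empty v (this ▸ ⟨hv, hvA⟩)
  · intro u v h5 h6 h7 h8 huv hu
    rw [hp] at h5 h7
    rw [hq] at h6 h8
    obtain ⟨v₁, hv₁, v₂, hv₂, hv⟩ := h4 _ _ huv
    refine ⟨v₂, hv₂, ?_⟩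
    exact (hf' _ _ hv₂ h7 h8).resolve_right fun hB => hAB v₁ (hA _ h5 h6 hu hv₁) v₂ hB hv

theorem addEdge_adj {V : Type} (G : SimpleGraph V) (a b u v : V) :
    (addEdge G a b).Adj u v ↔ G.Adj u v ∨ (((u = a ∧ v = b) ∨ (u = b ∧ v = a)) ∧ u ≠ v) := by
  simp [addEdge]

theorem not_linkless {V : Type} {G : SimpleGraph V} (h : ¬ IsLinkless G) :
    ∃ (W : Type) (P : SimpleGraph W), IsPetersenFamily P ∧ MIn P G Set.univ := by
  unfold IsLinkless at h
  push Not at h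
  obtain ⟨W, P, hP, h⟩ := h
  exact ⟨W, P, hP, (isMinor_iff _ _).1 h⟩

/-- A connected maxnil graph has no cut vertex. -/
theorem no_cut_vertex {V : Type} {G : SimpleGraph V} (hG : IsMaxnil G) (hc : Conn G Set.univ)
    (x : V) (A B : Set V) (hx : x ∉ A) (hx' : x ∉ B) (hcov : ∀ v, v ∈ A ∨ v ∈ B ∨ v = x)
    (hdis : ∀ v ∈ A, v ∉ B) (hA : A.Nonempty) (hB : B.Nonempty)
    (hAB : ∀ u ∈ A, ∀ v ∈ B, ¬ G.Adj u v) : False := by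
  have nb : ∀ A B : Set V, x ∉ A → (∀ v, v ∈ A ∨ v ∈ B ∨ v = x) → (∀ v ∈ A, v ∉ B) →
      A.Nonempty → (∀ u ∈ A, ∀ v ∈ B, ¬ G.Adj u v) → ∃ u ∈ A, G.Adj x u := by
    intro A B hx hcov hdis hA hAB
    by_contra hno
    push Not at hno
    obtain ⟨a, ha⟩ := hA
    have := hc.2 Aᶜ ⟨x, Set.mem_univ _, hx⟩ ?_ (Set.mem_univ a)
    · exact this ha
    · intro u _ v _ huv hu hv
      rcases hcov u with h | h | rfl
      · exact hu h
      · exact hAB v hv u h huv.symm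
      · exact hno v hv huv
  obtain ⟨u, huA, hxu⟩ := nb A B hx hcov hdis hA hAB
  obtain ⟨w, hwB, hxw⟩ := nb B A hx' (fun v => by have := hcov v; tauto)
    (fun v hv hv' => hdis v hv' hv) hB (fun a ha b hb h => hAB b hb a ha h.symm)
  have huB := hdis u huA
  have hwA : w ∉ A := fun h => hdis w h hwB
  have huw : u ≠ w := fun h => huB (h ▸ hwB)
  obtain ⟨W, P, hP, hM⟩ := not_linkless (hG.2 u w huw (hAB u huA w hwB))
  have hnG : ¬ MIn P G Set.univ := fun h => hG.1 P hP ((isMinor_iff _ _).2 h)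
  have hle : ∀ a b, G.Adj a b → (addEdge G u w).Adj a b := fun a b h =>
    (addEdge_adj _ _ _ _ _).2 (Or.inl h)
  have hxA : x ≠ u := hxu.ne
  have hxB : x ≠ w := hxw.ne
  have d1 : ∀ a ∈ A \ {u}, ∀ b ∈ B, ¬ (addEdge G u w).Adj a b := by
    intro a ha b hb hab
    rw [addEdge_adj] at hab
    simp at ha
    grind
  have d2 : (Set.univ : Set V) ⊆ A \ {u} ∪ B ∪ {u, x} := by
    intro a _
    have := hcov a
    simp
    grind
  have d3 : ∀ a ∈ ({u} : Set V), ∀ b ∈ B \ {w}, ¬ (addEdge G u w).Adj a b := by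
    intro a ha b hb hab
    rw [addEdge_adj] at hab
    simp at ha hb
    grind
  have d4 : B ∪ {u, x} ⊆ {u} ∪ B \ {w} ∪ {x, w} := by
    intro a ha
    simp at ha ⊢
    grind
  rcases sum_lemma hP.threeConn (hle _ _ hxu.symm) d1 d2 hM with h | h
  · refine hnG (h.mono (Set.subset_univ _) ?_)
    intro a ha b hb hab
    rw [addEdge_adj] at hab
    simp at ha hb
    grind
  · rcases sum_lemma hP.threeConn (hle _ _ hxw) d3 d4 h with h | h
    · have h1 := h.card_le (by simp)
      have h2 := hP.card
      have h3 : (({u} : Set V) ∪ {x, w}).ncard ≤ 3 := by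
        refine (Set.ncard_union_le _ _).trans ?_
        have := Set.ncard_insert_le x ({w} : Set V)
        simp at this ⊢
        omega
      omega
    · refine hnG (h.mono (Set.subset_univ _) ?_)
      intro a ha b hb hab
      rw [addEdge_adj] at hab
      simp at ha hb
      grind

/-- A connected set attached to both `x` and `y` can play the role of the edge `xy`. -/
theorem contract {W V : Type} {P : SimpleGraph W} {G : SimpleGraph V} {x y : V} {C D : Set V}
    (hC : Conn G C) (hD : ∀ v ∈ C, v ∉ D)
    {c₁ c₂ : V} (hc₁ : c₁ ∈ C) (hc₂ : c₂ ∈ C) (h₁ : G.Adj c₁ x) (h₂ : G.Adj c₂ y)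
    (h : MIn P (addEdge G x y) D) : MIn P G Set.univ := by
  obtain ⟨f, k1, k2, k3, k4⟩ := h
  refine ⟨fun w => f w ∪ {v | v ∈ C ∧ x ∈ f w}, fun w => Set.subset_univ _, ?_, ?_, ?_⟩
  · intro w
    by_cases hx : x ∈ f w
    · have he : f w ∪ {v | v ∈ C ∧ x ∈ f w} = f w ∪ C := by
        ext v
        simp [hx]
      simp only [he]
      refine ⟨⟨x, Or.inl hx⟩, ?_⟩
      intro Q hQ0 hQ
      have hCQ : (∃ v ∈ C, v ∈ Q) → C ⊆ Q := fun hv =>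
        hC.2 Q hv fun a ha b hb hab => hQ a (Or.inr ha) b (Or.inr hb) hab
      have hmain : (∃ v ∈ C, v ∈ Q) → f w ∪ C ⊆ Q := by
        intro hv
        have h5 := hCQ hv
        have hxQ : x ∈ Q := hQ c₁ (Or.inr hc₁) x (Or.inl hx) h₁ (h5 hc₁)
        refine Set.union_subset ((k2 w).2 Q ⟨x, hx, hxQ⟩ ?_) h5
        intro a ha b hb hab haQ
        rw [addEdge_adj] at hab
        rcases hab with hab | ⟨⟨-, rfl⟩ | ⟨-, rfl⟩, -⟩
        · exact hQ a (Or.inl ha) b (Or.inl hb) hab haQ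
        · exact hQ c₂ (Or.inr hc₂) b (Or.inl hb) h₂ (h5 hc₂)
        · exact hxQ
      by_cases hv : ∃ v ∈ C, v ∈ Q
      · exact hmain hv
      · exfalso
        obtain ⟨z, hz | hz, hzQ⟩ := hQ0
        · have hxQ : x ∉ Q := fun h =>
            hv ⟨c₁, hc₁, hQ x (Or.inl hx) c₁ (Or.inr hc₁) h₁.symm h⟩
          refine hxQ ((k2 w).2 Q ⟨z, hz, hzQ⟩ ?_ hx)
          intro a ha b hb hab haQ
          rw [addEdge_adj] at hab
          rcases hab with hab | ⟨⟨rfl, -⟩ | ⟨rfl, -⟩, -⟩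
          · exact hQ a (Or.inl ha) b (Or.inl hb) hab haQ
          · exact absurd haQ hxQ
          · exact absurd ⟨c₂, hc₂, hQ a (Or.inl ha) c₂ (Or.inr hc₂) h₂.symm haQ⟩ hv
        · exact hv ⟨z, hz, hzQ⟩
    · have he : f w ∪ {v | v ∈ C ∧ x ∈ f w} = f w := by
        ext v
        simp [hx]
      simp only [he]
      refine (k2 w).mono ?_
      intro a ha b hb hab
      rw [addEdge_adj] at hab
      rcases hab with hab | ⟨⟨rfl, -⟩ | ⟨-, rfl⟩, -⟩
      · exact hab
      · exact absurd ha hx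
      · exact absurd hb hx
  · rintro w₁ w₂ v (hv1 | hv1) (hv2 | hv2)
    · exact k3 _ _ _ hv1 hv2
    · exact absurd (k1 _ hv1) (hD v hv2.1)
    · exact absurd (k1 _ hv2) (hD v hv1.1)
    · exact k3 _ _ _ hv1.2 hv2.2
  · intro w₁ w₂ hw
    obtain ⟨v₁, hv₁, v₂, hv₂, hv⟩ := k4 _ _ hw
    rw [addEdge_adj] at hv
    rcases hv with hv | ⟨⟨rfl, rfl⟩ | ⟨rfl, rfl⟩, -⟩
    · exact ⟨v₁, Or.inl hv₁, v₂, Or.inl hv₂, hv⟩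
    · exact ⟨c₂, Or.inr ⟨hc₂, hv₁⟩, v₂, Or.inl hv₂, h₂⟩
    · exact ⟨v₁, Or.inl hv₁, c₂, Or.inr ⟨hc₂, hv₂⟩, h₂.symm⟩

/-- The facts about a component of `G - {x, y}` that are needed. -/
theorem comp_facts {V : Type} (G : SimpleGraph V) (x y : V)
    (C : (G.induce ({x, y} : Set V)ᶜ).ConnectedComponent) :
    Conn G (Subtype.val '' C.supp) ∧ x ∉ Subtype.val '' C.supp ∧ y ∉ Subtype.val '' C.supp ∧
    ∀ u ∈ Subtype.val '' C.supp, ∀ v, v ∉ Subtype.val '' C.supp → v ≠ x → v ≠ y →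
      ¬ G.Adj u v := by
  refine ⟨?_, ?_, ?_, ?_⟩
  · rw [← conn_induce, ← conn_iff]
    exact C.connected_toSimpleGraph
  · rintro ⟨v, -, hv⟩
    exact v.2 (by simp [hv])
  · rintro ⟨v, -, hv⟩
    exact v.2 (by simp [hv])
  · rintro _ ⟨u, hu, rfl⟩ v hv hvx hvy huv
    apply hv
    refine ⟨⟨v, by simp [hvx, hvy]⟩, ?_, rfl⟩
    rw [ConnectedComponent.mem_supp_iff] at hu ⊢
    rw [← hu]
    apply ConnectedComponent.sound
    apply Adj.reachable
    exact huv.symm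

theorem induce_addEdge {V : Type} (G : SimpleGraph V) (S : Set V) (a b : S) :
    addEdge (G.induce S) a b = (addEdge G a b).induce S := by
  ext u v
  rw [addEdge_adj, SimpleGraph.induce_adj, SimpleGraph.induce_adj, addEdge_adj]
  simp only [Subtype.ext_iff, ne_eq]

/-- If `G` is maxnil with a vertex cut set `S = {x, y}` of two distinct vertices, then
`xy ∈ E(G)`, and for every connected component `C` of `G - S` the subgraph of `G`
induced by `V(C) ∪ S` is maxnil. -/
theorem stmt_5 {V : Type} [Fintype V] (G : SimpleGraph V) (x y : V) (hxy : x ≠ y)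
    (hG : IsMaxnil G) (hcut : IsVertexCut G {x, y}) :
    G.Adj x y ∧
    ∀ C : (G.induce ({x, y} : Set V)ᶜ).ConnectedComponent,
      IsMaxnil (G.induce (Subtype.val '' C.supp ∪ {x, y})) := by
  classical
  have hconn : Conn G Set.univ := by
    refine ⟨?_, ?_⟩
    · exact ⟨x, trivial⟩
    · have h1 := (conn_iff G Set.univ).1 ((SimpleGraph.induceUnivIso G).connected_iff.2 hcut.1)
      exact h1.2
  have hnG : ∀ {W : Type} (P : SimpleGraph W), IsPetersenFamily P → ¬ MIn P G Set.univ :=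
    fun P hP h => hG.1 P hP ((isMinor_iff _ _).2 h)
  -- every component is attached to both `x` and `y`
  have hatt : ∀ C : (G.induce ({x, y} : Set V)ᶜ).ConnectedComponent,
      (∃ c ∈ Subtype.val '' C.supp, G.Adj c x) ∧ (∃ c ∈ Subtype.val '' C.supp, G.Adj c y) := by
    intro C
    obtain ⟨hC, hx, hy, hnb⟩ := comp_facts G x y C
    generalize Subtype.val '' C.supp = K at hC hx hy hnb
    constructor
    · by_contra hno
      push Not at hno
      refine no_cut_vertex hG hconn y K (Kᶜ \ {y}) hy (by simp) ?_ ?_ hC.1 ⟨x, hx, hxy⟩ ?_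
      · intro v
        simp
        tauto
      · intro v hv hv'
        exact hv'.1 hv
      · intro u hu v hv huv
        by_cases hvx : v = x
        · subst hvx
          exact hno u hu huv
        · exact hnb u hu v hv.1 hvx hv.2 huv
    · by_contra hno
      push Not at hno
      refine no_cut_vertex hG hconn x K (Kᶜ \ {x}) hx (by simp) ?_ ?_ hC.1 ⟨y, hy, hxy.symm⟩ ?_
      · intro v
        simp
        tauto
      · intro v hv hv'
        exact hv'.1 hv
      · intro u hu v hv huv
        by_cases hvy : v = y
        · subst hvy
          exact hno u hu huv
        · exact hnb u hu v hv.1 hv.2 hvy huv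
  have hadj : G.Adj x y := by
    by_contra hno
    obtain ⟨W, P, hP, hM⟩ := not_linkless (hG.2 x y hxy hno)
    have hnp := hcut.2
    unfold SimpleGraph.Preconnected at hnp
    push Not at hnp
    obtain ⟨u, v, huv⟩ := hnp
    let C := (G.induce ({x, y} : Set V)ᶜ).connectedComponentMk u
    let C' := (G.induce ({x, y} : Set V)ᶜ).connectedComponentMk v
    have hCC : C ≠ C' := fun h => huv (ConnectedComponent.exact h)
    obtain ⟨hC, hx, hy, hnb⟩ := comp_facts G x y C
    obtain ⟨hC', hx', hy', hnb'⟩ := comp_facts G x y C'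
    obtain ⟨⟨c₁, hc₁, h₁⟩, ⟨c₂, hc₂, h₂⟩⟩ := hatt C
    obtain ⟨⟨d₁, hd₁, k₁⟩, ⟨d₂, hd₂, k₂⟩⟩ := hatt C'
    have hdis : ∀ v ∈ Subtype.val '' C.supp, v ∉ Subtype.val '' C'.supp := by
      rintro _ ⟨z, hz, rfl⟩ ⟨z', hz', he⟩
      rw [Subtype.ext he] at hz'
      rw [ConnectedComponent.mem_supp_iff] at hz hz'
      exact hCC (hz.symm.trans hz')
    generalize Subtype.val '' C.supp = K at *
    generalize Subtype.val '' C'.supp = K' at *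
    have d1 : ∀ p ∈ K, ∀ q ∈ Kᶜ \ {x, y}, ¬ (addEdge G x y).Adj p q := by
      intro p hp q hq hpq
      rw [addEdge_adj] at hpq
      simp at hq
      grind
    have d2 : (Set.univ : Set V) ⊆ K ∪ (Kᶜ \ {x, y}) ∪ {x, y} := by
      intro p _
      by_cases h1 : p ∈ K
      · exact Or.inl (Or.inl h1)
      by_cases h2 : p ∈ ({x, y} : Set V)
      · exact Or.inr h2
      · exact Or.inl (Or.inr ⟨h1, h2⟩)
    rcases sum_lemma hP.threeConn (s := x) (t := y) (A := K) (B := Kᶜ \ {x, y})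
      ((addEdge_adj _ _ _ _ _).2 (Or.inr ⟨Or.inl ⟨rfl, rfl⟩, hxy⟩)) d1 d2 hM with h | h
    · refine hnG P hP (contract hC' ?_ hd₁ hd₂ k₁ k₂ h)
      intro z hz hz'
      simp at hz'
      grind
    · refine hnG P hP (contract hC ?_ hc₁ hc₂ h₁ h₂ h)
      intro z hz hz'
      simp at hz'
      grind
  refine ⟨hadj, ?_⟩
  intro C
  obtain ⟨hC, hx, hy, hnb⟩ := comp_facts G x y C
  generalize Subtype.val '' C.supp = K at *
  constructor
  · intro W P hP hM
    rw [isMinor_induce_iff] at hM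
    exact hnG P hP (hM.mono (Set.subset_univ _) fun _ _ _ _ h => h)
  · rintro ⟨a, ha⟩ ⟨b, hb⟩ hab hnab hL
    have hab' : a ≠ b := fun h => hab (Subtype.ext h)
    have hnab' : ¬ G.Adj a b := hnab
    rw [induce_addEdge] at hL
    obtain ⟨W, P, hP, hM⟩ := not_linkless (hG.2 a b hab' hnab')
    have hyx := hadj.symm
    have ha' : a = x ∨ a = y ∨ a ∈ K := by
      simp at ha
      tauto
    have hb' : b = x ∨ b = y ∨ b ∈ K := by
      simp at hb
      tauto
    have d1 : ∀ p ∈ K, ∀ q ∈ Kᶜ \ {x, y}, ¬ (addEdge G a b).Adj p q := by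
      intro p hp q hq hpq
      rw [addEdge_adj] at hpq
      simp at hq
      grind
    have d2 : (Set.univ : Set V) ⊆ K ∪ (Kᶜ \ {x, y}) ∪ {x, y} := by
      intro p _
      by_cases h1 : p ∈ K
      · exact Or.inl (Or.inl h1)
      by_cases h2 : p ∈ ({x, y} : Set V)
      · exact Or.inr h2
      · exact Or.inl (Or.inr ⟨h1, h2⟩)
    rcases sum_lemma hP.threeConn (s := x) (t := y) (A := K) (B := Kᶜ \ {x, y})
      ((addEdge_adj _ _ _ _ _).2 (Or.inl hadj)) d1 d2 hM with h | h
    · exact hL P hP ((isMinor_induce_iff _ _ _).2 h)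
    · refine hnG P hP (h.mono (Set.subset_univ _) ?_)
      intro u hu v hv huv
      rw [addEdge_adj] at huv
      simp at hu hv
      grind
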